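/- Let E be a Polish space and (P_t)_{t≥0} a family of Markov (probability) kernels on E such that P_0 is the identity kernel, P_{t+s} = P_t ∘ P_s for all s,t ≥ 0, the map (t,x) ↦ P_t f(x) := ∫_E f(y) P_t(x,dy) is measurable in t for each x and each bounded measurable f, and P_t maps bounded continuous functions to bounded continuous functions. Suppose there exist a measurable function V: E → [0,∞), a continuous function G: E → ℝ, and a constant m ∈ ℝ such that: G(x) ≤ m for all x; the set {x ∈ E : G(x) ≥ −N} is compact for every N > 0; for all t ≥ 0 and x ∈ E, V is P_t(x,·)-integrable and G is P_s(x,·)-integrable with s ↦ P_s G(x) locally integrable on [0,∞); and P_t V(x) = V(x) + ∫_0^t P_s G(x) ds for all t ≥ 0 and x ∈ E. Then there exists a Borel probability measure μ on E that is invariant for the semigroup, i.e. ∫_E P_t f dμ = ∫_E f dμ for every bounded continuous f: E → ℝ and every t > 0. -/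

import Mathlib

open MeasureTheory ProbabilityTheory

/-- Uniform probability measure on `(0, T]`. -/
noncomputable def kbTime (T : ℝ) : Measure ℝ :=
  ENNReal.ofReal T⁻¹ • (volume : Measure ℝ).restrict (Set.Ioc 0 T)

lemma kbTime_prob {T : ℝ} (hT : 0 < T) : IsProbabilityMeasure (kbTime T) := by
  constructor
  simp only [kbTime, Measure.smul_apply, Measure.restrict_apply MeasurableSet.univ, Set.univ_inter,
    Real.volume_Ioc, sub_zero, smul_eq_mul]
  rw [← ENNReal.ofReal_mul (by positivity), inv_mul_cancel₀ hT.ne', ENNReal.ofReal_one]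

lemma kbTime_integral {T : ℝ} (hT : 0 < T) (g : ℝ → ℝ) :
    ∫ s, g s ∂(kbTime T) = T⁻¹ * ∫ s in (0 : ℝ)..T, g s := by
  rw [kbTime, integral_smul_measure, intervalIntegral.integral_of_le hT.le,
    ENNReal.toReal_ofReal (by positivity), smul_eq_mul]

lemma kb_integral_comp {α β : Type*} [MeasurableSpace α] [MeasurableSpace β]
    (κ : Kernel α β) (μ : Measure α) [IsMarkovKernel κ] [IsProbabilityMeasure μ]
    (g : β → ℝ) (hg : Measurable g) (hC : ∃ C : ℝ, ∀ y, |g y| ≤ C) :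
    ∫ y, g y ∂(κ ∘ₘ μ) = ∫ x, ∫ y, g y ∂(κ x) ∂μ := by
  obtain ⟨C, hC⟩ := hC
  have h := Kernel.integral_comp (κ := Kernel.const Unit μ) (η := κ) (a := ()) (f := g)
  rw [← Measure.comp_eq_comp_const_apply] at h
  exact h (Integrable.of_bound hg.aestronglyMeasurable C
    (Filter.Eventually.of_forall fun y => by simpa using hC y))

/-- Krylov–Bogoliubov-type existence of an invariant measure with a Lyapunov function.
Let `E` be a (nonempty) Polish space and `(P_t)_{t≥0}` a family of Markov kernels on `E` such
that `P_0` is the identity kernel, `P_{t+s} = P_t ∘ P_s` for `s,t ≥ 0`, `t ↦ P_t f(x)` is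
measurable for bounded measurable `f`, and each `P_t` maps bounded continuous functions to
bounded continuous functions.  Suppose there are a measurable `V : E → [0,∞)`, a continuous
`G : E → ℝ` and `m ∈ ℝ` with `G ≤ m`, `{G ≥ −N}` compact for every `N > 0`, the stated
integrability, and the Dynkin-type identity `P_t V(x) = V(x) + ∫_0^t P_s G(x) ds`.  Then there
exists an invariant Borel probability measure `μ`:
`∫ P_t f dμ = ∫ f dμ` for every bounded continuous `f` and every `t > 0`. -/
theorem stmt_17 {E : Type*} [TopologicalSpace E] [PolishSpace E] [MeasurableSpace E]
    [BorelSpace E] [Nonempty E]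
    (P : ℝ → Kernel E E) (hmarkov : ∀ t : ℝ, IsMarkovKernel (P t))
    (hP0 : ∀ x : E, P 0 x = Measure.dirac x)
    (hsemi : ∀ s t : ℝ, 0 ≤ s → 0 ≤ t → ∀ (x : E) (U : Set E), MeasurableSet U →
      P (t + s) x U = ∫⁻ y, P s y U ∂(P t x))
    (hmeas : ∀ (x : E) (f : E → ℝ), Measurable f → (∃ C : ℝ, ∀ y, |f y| ≤ C) →
      Measurable fun t : ℝ => ∫ y, f y ∂(P t x))
    (hfeller : ∀ t : ℝ, 0 ≤ t → ∀ f : E → ℝ, Continuous f → (∃ C : ℝ, ∀ y, |f y| ≤ C) →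
      Continuous fun x : E => ∫ y, f y ∂(P t x))
    (V : E → ℝ) (hVmeas : Measurable V) (hV0 : ∀ x, 0 ≤ V x)
    (G : E → ℝ) (hGcont : Continuous G) (m : ℝ) (hGm : ∀ x, G x ≤ m)
    (hcomp : ∀ N : ℝ, 0 < N → IsCompact {x : E | -N ≤ G x})
    (hVint : ∀ t : ℝ, 0 ≤ t → ∀ x : E, Integrable V (P t x))
    (hGint : ∀ s : ℝ, 0 ≤ s → ∀ x : E, Integrable G (P s x))
    (hGloc : ∀ (x : E) (t : ℝ), 0 ≤ t →
      IntegrableOn (fun s : ℝ => ∫ y, G y ∂(P s x)) (Set.Icc 0 t))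
    (hdynkin : ∀ t : ℝ, 0 ≤ t → ∀ x : E,
      ∫ y, V y ∂(P t x) = V x + ∫ s in (0 : ℝ)..t, ∫ y, G y ∂(P s x)) :
    ∃ μ : Measure E, IsProbabilityMeasure μ ∧
      ∀ f : E → ℝ, Continuous f → (∃ C : ℝ, ∀ y, |f y| ≤ C) → ∀ t : ℝ, 0 < t →
        ∫ x, (∫ y, f y ∂(P t x)) ∂μ = ∫ x, f x ∂μ := by
  classical
  have := hmarkov
  obtain ⟨x0⟩ := ‹Nonempty E›
  -- the kernel `t ↦ P t x0`
  have hκm : Measurable fun t : ℝ => P t x0 := by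
    refine Measure.measurable_of_measurable_coe _ fun s hs => ?_
    have h := hmeas x0 (s.indicator fun _ => (1 : ℝ)) (measurable_const.indicator hs)
      ⟨1, fun y => by by_cases hy : y ∈ s <;> simp [hy]⟩
    have h2 : (fun t : ℝ => P t x0 s) =
        fun t : ℝ => ENNReal.ofReal (∫ y, s.indicator (fun _ => (1 : ℝ)) y ∂(P t x0)) := by
      funext t
      rw [integral_indicator_const _ hs]
      simp
    rw [h2]
    exact h.ennreal_ofReal
  let κ : Kernel ℝ E := ⟨fun t => P t x0, hκm⟩
  have : IsMarkovKernel κ := ⟨fun t => (hmarkov t).isProbabilityMeasure x0⟩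
  have hκ : ∀ t, κ t = P t x0 := fun t => rfl
  -- the averages
  let T : ℕ → ℝ := fun n => (n : ℝ) + 1
  have hT : ∀ n, 1 ≤ T n := fun n => by simp [T]
  let μ : ℕ → Measure E := fun n => κ ∘ₘ kbTime (T n)
  have : ∀ n, IsProbabilityMeasure (kbTime (T n)) := fun n =>
    kbTime_prob (lt_of_lt_of_le one_pos (hT n))
  have : ∀ n, IsProbabilityMeasure (μ n) := fun n => by dsimp only [μ]; infer_instance
  let M : ℕ → ProbabilityMeasure E := fun n => ⟨μ n, inferInstance⟩
  have hμint : ∀ n (g : E → ℝ), Measurable g → (∃ C : ℝ, ∀ y, |g y| ≤ C) →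
      ∫ x, g x ∂(μ n) = (T n)⁻¹ * ∫ s in (0 : ℝ)..(T n), ∫ y, g y ∂(P s x0) := by
    intro n g hg hC
    rw [kb_integral_comp _ _ g hg hC, kbTime_integral (lt_of_lt_of_le one_pos (hT n))]
    rfl
  have hbd : ∀ (g : E → ℝ) (C : ℝ), (∀ y, |g y| ≤ C) → ∀ t x, |∫ y, g y ∂(P t x)| ≤ C := by
    intro g C hC t x
    have := norm_integral_le_of_norm_le_const (μ := P t x) (f := g) (C := C)
      (Filter.Eventually.of_forall fun y => by simpa using hC y)
    simpa using this
  have hII : ∀ (g : E → ℝ), Measurable g → (∃ C : ℝ, ∀ y, |g y| ≤ C) → ∀ a b,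
      IntervalIntegrable (fun s => ∫ y, g y ∂(P s x0)) volume a b := by
    rintro g hg ⟨C, hC⟩ a b
    rw [intervalIntegrable_iff]
    exact Measure.integrableOn_of_bounded (M := C) (by simp)
      (hmeas x0 g hg ⟨C, hC⟩).aestronglyMeasurable
      (Filter.Eventually.of_forall fun s => by simpa using hbd g C hC s x0)
  -- tightness
  have htight : IsTightMeasureSet
      {((ν : ProbabilityMeasure E) : Measure E) |
        ν ∈ Set.range M} := by
    rw [isTightMeasureSet_iff_exists_isCompact_measure_compl_le]
    intro ε hε
    obtain ⟨δ, hδ, hδε⟩ : ∃ δ : ℝ, 0 < δ ∧ ENNReal.ofReal δ ≤ ε := by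
      by_cases htop : ε = ⊤
      · exact ⟨1, one_pos, by simp [htop]⟩
      · exact ⟨ε.toReal, ENNReal.toReal_pos hε.ne' htop, by rw [ENNReal.ofReal_toReal htop]⟩
    set B : ℝ := |m| + V x0 with hB
    have hB0 : 0 ≤ B := add_nonneg (abs_nonneg _) (hV0 _)
    set a : ℝ := B / δ + 1 + 2 * |m| with ha
    have hBδ : 0 ≤ B / δ := div_nonneg hB0 hδ.le
    have habs := neg_abs_le m
    have habs' := le_abs_self m
    have ham : 0 < a - m := by have := abs_nonneg m; linarith
    have ha0 : 0 < a := by have := abs_nonneg m; linarith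
    refine ⟨{x | -(a - m) ≤ G x}, hcomp _ ham, ?_⟩
    rintro _ ⟨_, ⟨n, rfl⟩, rfl⟩
    change μ n _ ≤ ε
    set A : Set E := {x | a ≤ m - G x} with hA
    have hAm : MeasurableSet A :=
      measurableSet_le measurable_const (measurable_const.sub hGcont.measurable)
    have hsub : {x | -(a - m) ≤ G x}ᶜ ⊆ A := by
      intro x hx
      simp only [Set.mem_compl_iff, Set.mem_ofPred_eq, not_le] at hx
      simp only [hA, Set.mem_ofPred_eq]
      linarith
    refine (measure_mono hsub).trans (le_trans ?_ hδε)
    have hind := hμint n (A.indicator fun _ => (1 : ℝ)) (measurable_const.indicator hAm)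
      ⟨1, fun y => by by_cases hy : y ∈ A <;> simp [hy]⟩
    have hind2 := hII (A.indicator fun _ => (1 : ℝ)) (measurable_const.indicator hAm)
      ⟨1, fun y => by by_cases hy : y ∈ A <;> simp [hy]⟩ 0 (T n)
    simp only [integral_indicator_const _ hAm, smul_eq_mul, mul_one] at hind hind2
    have hTn := hT n
    have hT0 : 0 ≤ T n := by linarith
    have hGI : IntervalIntegrable (fun s => ∫ y, G y ∂(P s x0)) volume 0 (T n) := by
      rw [intervalIntegrable_iff_integrableOn_Icc_of_le hT0]
      exact hGloc x0 _ hT0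
    have hle : ∫ s in (0 : ℝ)..(T n), a * (P s x0).real A ≤
        ∫ s in (0 : ℝ)..(T n), (m - ∫ y, G y ∂(P s x0)) := by
      refine intervalIntegral.integral_mono_on hT0 (hind2.const_mul a)
        (intervalIntegrable_const.sub hGI) ?_
      intro s hs
      have h1 := mul_meas_ge_le_integral_of_nonneg (μ := P s x0) (f := fun x => m - G x)
        (Filter.Eventually.of_forall fun x => by simpa using hGm x)
        ((integrable_const m).sub (hGint s hs.1 x0)) a
      rw [integral_sub (integrable_const m) (hGint s hs.1 x0)] at h1
      simpa using h1
    rw [intervalIntegral.integral_const_mul,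
      intervalIntegral.integral_sub intervalIntegrable_const hGI] at hle
    simp only [intervalIntegral.integral_const, smul_eq_mul, sub_zero] at hle
    have hdy := hdynkin (T n) hT0 x0
    have hVn : 0 ≤ ∫ y, V y ∂(P (T n) x0) := integral_nonneg hV0
    have hfin : (μ n).real A ≤ δ := by
      rw [hind, inv_mul_le_iff₀ (by linarith)]
      have h3 : a * ∫ s in (0 : ℝ)..(T n), (P s x0).real A ≤ T n * B := by
        have h4 : T n * m ≤ T n * |m| := mul_le_mul_of_nonneg_left habs' hT0
        have h5 : V x0 ≤ T n * V x0 := le_mul_of_one_le_left (hV0 _) hTn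
        rw [hB, mul_add]
        linarith
      have h6 : B ≤ a * δ := by
        have : B / δ ≤ a := by have := abs_nonneg m; linarith
        rwa [div_le_iff₀ hδ] at this
      have h7 : T n * B ≤ a * (T n * δ) := by
        calc T n * B ≤ T n * (a * δ) := mul_le_mul_of_nonneg_left h6 hT0
          _ = _ := by ring
      exact le_of_mul_le_mul_left (h3.trans h7) ha0
    rw [← ofReal_measureReal]
    exact ENNReal.ofReal_le_ofReal hfin
  have hcpt := isCompact_closure_of_isTightMeasureSet htight
  -- limit along an ultrafilter
  let U : Ultrafilter ℕ := Ultrafilter.of Filter.atTop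
  have hU : (U : Filter ℕ) ≤ Filter.atTop := Ultrafilter.of_le _
  obtain ⟨ν, -, hν⟩ := hcpt.ultrafilter_le_nhds
    (U.map M)
    (by
      rw [Filter.le_principal_iff]
      exact Filter.mem_map.2 (Filter.Eventually.of_forall fun n =>
        subset_closure ⟨n, rfl⟩))
  have hν' : Filter.Tendsto M
      (U : Filter ℕ) (nhds ν) := hν
  rw [ProbabilityMeasure.tendsto_iff_forall_integral_tendsto] at hν'
  refine ⟨ν, inferInstance, ?_⟩
  rintro f hf ⟨C, hC⟩ t ht
  have key : ∀ g : E → ℝ, Continuous g → (∃ C : ℝ, ∀ y, |g y| ≤ C) →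
      Filter.Tendsto (fun n => ∫ x, g x ∂(μ n)) (U : Filter ℕ) (nhds (∫ x, g x ∂(ν : Measure E))) := by
    rintro g hg ⟨C, hC⟩
    exact hν' (BoundedContinuousFunction.ofNormedAddCommGroup g hg C hC)
  have hg := hfeller t ht.le f hf ⟨C, hC⟩
  have h1 := key f hf ⟨C, hC⟩
  have h2 := key _ hg ⟨C, hbd f C hC t⟩
  have h3 : Filter.Tendsto (fun n => ∫ x, (∫ y, f y ∂(P t x)) ∂(μ n) - ∫ x, f x ∂(μ n))
      (U : Filter ℕ) (nhds 0) := by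
    refine Filter.Tendsto.mono_left ?_ hU
    refine squeeze_zero_norm
      (f := fun n => ∫ x, (∫ y, f y ∂(P t x)) ∂(μ n) - ∫ x, f x ∂(μ n)) (a := fun n => 2 * (C * t) * (1 / ((n : ℝ) + 1))) ?_ ?_
    · intro n
      have hTn := hT n
      have hck : ∀ s ∈ Set.uIcc 0 (T n), ∫ x, (∫ y, f y ∂(P t x)) ∂(P s x0)
          = ∫ y, f y ∂(P (s + t) x0) := by
        intro s hs
        rw [Set.uIcc_of_le (by linarith)] at hs
        have : P (s + t) x0 = P t ∘ₘ P s x0 := by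
          ext A hA
          rw [hsemi t s ht.le hs.1 x0 A hA, Measure.bind_apply hA (P t).aemeasurable]
        rw [this, kb_integral_comp _ _ f hf.measurable ⟨C, hC⟩]
      rw [hμint n _ hg.measurable ⟨C, hbd f C hC t⟩, hμint n f hf.measurable ⟨C, hC⟩, ← mul_sub,
        intervalIntegral.integral_congr hck,
        intervalIntegral.integral_comp_add_right (fun s => ∫ y, f y ∂(P s x0)) t, zero_add]
      have hI := hII f hf.measurable ⟨C, hC⟩
      have e1 := intervalIntegral.integral_add_adjacent_intervals (hI 0 t) (hI t (T n + t))
      have e2 := intervalIntegral.integral_add_adjacent_intervals (hI 0 (T n)) (hI (T n) (T n + t))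
      have b1 := intervalIntegral.norm_integral_le_of_norm_le_const (a := 0) (b := t)
        (f := fun s => ∫ y, f y ∂(P s x0)) (C := C) fun s _ => hbd f C hC s x0
      have b2 := intervalIntegral.norm_integral_le_of_norm_le_const (a := T n) (b := T n + t)
        (f := fun s => ∫ y, f y ∂(P s x0)) (C := C) fun s _ => hbd f C hC s x0
      simp only [Real.norm_eq_abs, sub_zero, add_sub_cancel_left, abs_of_pos ht] at b1 b2
      rw [norm_mul, Real.norm_eq_abs, Real.norm_eq_abs, abs_of_pos (by positivity : 0 < (T n)⁻¹),
        one_div, mul_comm]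
      refine mul_le_mul_of_nonneg_right ?_ (by positivity)
      rw [abs_le] at b1 b2 ⊢
      constructor <;> linarith [b1.1, b1.2, b2.1, b2.2]
    · simpa using (tendsto_one_div_add_atTop_nhds_zero_nat (𝕜 := ℝ)).const_mul (2 * (C * t))
  have h4 := tendsto_nhds_unique h3 (h2.sub h1)
  linarith
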